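/- Let I be the interpreted system of the FloodSet information exchange E^flood under Crash_t, and let (r,m) be a point of I. Then (I,r,m) ⊨ K_i(C_N(∃0)) ∨ K_i(C_N(∃1)) holds for all i ∈ N(r,m) if and only if m ≥ min{t+1, n−1}. -/

import Mathlib

namespace SBA

/-- The set of values `{0,1}`; `false` plays the role of `0`, `true` of `1`. -/
abbrev Values := Bool

/-- Actions of an agent in the SBA problem: decide a value, or do nothing. -/
inductive Action where
  | decide (v : Values)
  | noop
deriving DecidableEq

/-- An adversary: `F m i j = false` means agent `i`'s round-`m` message to `j`
is not delivered. -/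
structure Adversary (n : ℕ) where
  F : ℕ → Fin n → Fin n → Bool

/-- Validity of an adversary for the crash failure model `Crash_t`:
crashes are permanent, an undelivered message means the sender has crashed,
and at most `t` agents are faulty. -/
def Adversary.Valid {n : ℕ} (A : Adversary n) (t : ℕ) : Prop :=
  (∀ m i, A.F m i i = false → ∀ m', m < m' → ∀ k, A.F m' i k = false) ∧
  (∀ m i j, A.F m i j = false → A.F m i i = false) ∧
  {i : Fin n | ∃ m j, A.F m i j = false}.ncard ≤ t

/-- An information exchange: local state types, message types, the special
`crashed` state, a (bijective) choice of initial state for each initial value,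
the message selection function `μ` and the state update function `δ`. -/
structure InfoExchange (n : ℕ) where
  L : Fin n → Type
  M : Fin n → Type
  crashSt : ∀ i, L i
  initSt : ∀ i, Values → L i
  initInj : ∀ i, Function.Injective (initSt i)
  μ : ∀ i, L i → Action → (Fin n → Option (M i))
  δ : ∀ i, L i → Adversary n → Action → ((j : Fin n) → Option (M j)) → L i

/-- A decision protocol for information exchange `E`: each agent maps its
local state to an action. -/
def DecProtocol {n : ℕ} (E : InfoExchange n) := ∀ i : Fin n, E.L i → Action

/-- A run: a (constant) environment state (the adversary) together with, for
each time, a local state for each agent. -/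
structure Run {n : ℕ} (E : InfoExchange n) where
  env : Adversary n
  st : ℕ → (i : Fin n) → E.L i

/-- The vector of messages received by agent `i` in round `k+1`. -/
def recvd {n : ℕ} (E : InfoExchange n) (P : DecProtocol E) (r : Run E) (k : ℕ)
    (i : Fin n) : (j : Fin n) → Option (E.M j) :=
  fun j => if r.env.F (k+1) j i = true
           then E.μ j (r.st k j) (P j (r.st k j)) i else none

/-- Agent `i` has not been crashed by the adversary up to (and including) round `m`. -/
def aliveAt {n : ℕ} (A : Adversary n) (m : ℕ) (i : Fin n) : Prop :=
  ∀ k ≤ m, A.F k i i = true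

instance {n : ℕ} (A : Adversary n) (m : ℕ) (i : Fin n) : Decidable (aliveAt A m i) := by
  unfold aliveAt; infer_instance

/-- `r` is a run generated by decision protocol `P` with information exchange `E`
in the crash failure context `Crash_t`. -/
def IsRun {n : ℕ} (E : InfoExchange n) (P : DecProtocol E) (t : ℕ) (r : Run E) : Prop :=
  r.env.Valid t ∧
  (∀ i, ∃ v, r.st 0 i = E.initSt i v) ∧
  ∀ k i, r.st (k+1) i =
    if aliveAt r.env (k+1) i
    then E.δ i (r.st k i) r.env (P i (r.st k i)) (recvd E P r k i)
    else E.crashSt i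

/-- The interpreted system `I_{P,E,Crash_t}`: the set of runs of `(P,E)` in `Crash_t`. -/
def Runs {n : ℕ} (E : InfoExchange n) (P : DecProtocol E) (t : ℕ) : Set (Run E) :=
  {r | IsRun E P t r}

/-- Agent `i` is nonfailed at the point `(r,m)`, i.e. `i ∈ N(r,m)`. -/
def Nonfailed {n : ℕ} (E : InfoExchange n) (r : Run E) (m : ℕ) (i : Fin n) : Prop :=
  r.st m i ≠ E.crashSt i

/-- (Semantic) formulas: predicates on points. -/
abbrev Form {n : ℕ} (E : InfoExchange n) := Run E → ℕ → Prop

/-- Knowledge: `K_i φ` holds at `(r,m)` iff `φ` holds at every point of the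
system `R` that is indistinguishable to agent `i` from `(r,m)`. -/
def Kn {n : ℕ} (E : InfoExchange n) (R : Set (Run E)) (i : Fin n) (φ : Form E) : Form E :=
  fun r m => ∀ r' ∈ R, ∀ m', r.st m i = r'.st m' i → φ r' m'

/-- `E_N φ`: every nonfailed agent knows `φ`. -/
def EvK {n : ℕ} (E : InfoExchange n) (R : Set (Run E)) (φ : Form E) : Form E :=
  fun r m => ∀ i, Nonfailed E r m i → Kn E R i φ r m

/-- Common knowledge among the nonfailed agents: `E_N^k φ` for all `k ≥ 1`. -/
def CK {n : ℕ} (E : InfoExchange n) (R : Set (Run E)) (φ : Form E) : Form E :=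
  fun r m => ∀ k : ℕ, (EvK E R)^[k+1] φ r m

/-- The atomic proposition `∃v`: some agent has initial value `v` in the run. -/
def ExistsVal {n : ℕ} (E : InfoExchange n) (v : Values) : Form E :=
  fun r _m => ∃ i, r.st 0 i = E.initSt i v

/-- Two runs (of possibly different information exchanges) correspond: same
adversary and the same initial values for all agents. -/
def Corresponds {n : ℕ} (E1 E2 : InfoExchange n) (r1 : Run E1) (r2 : Run E2) : Prop :=
  r1.env = r2.env ∧ ∀ i, ∃ v, r1.st 0 i = E1.initSt i v ∧ r2.st 0 i = E2.initSt i v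

/-- Agreement: nonfailed agents decide the same value. -/
def Agreement {n : ℕ} (E : InfoExchange n) (P : DecProtocol E) (t : ℕ) : Prop :=
  ∀ r ∈ Runs E P t, ∀ (m m' : ℕ) (i j : Fin n) (v v' : Values),
    Nonfailed E r m i → Nonfailed E r m' j →
    P i (r.st m i) = Action.decide v → P j (r.st m' j) = Action.decide v' → v = v'

/-- Validity: any value decided by a nonfailed agent is some agent's initial value. -/
def ValidityP {n : ℕ} (E : InfoExchange n) (P : DecProtocol E) (t : ℕ) : Prop :=
  ∀ r ∈ Runs E P t, ∀ (m : ℕ) (i : Fin n) (v : Values),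
    Nonfailed E r m i → P i (r.st m i) = Action.decide v →
    ∃ j, r.st 0 j = E.initSt j v

/-- Simultaneity: if a nonfailed agent decides in a round, every nonfailed agent
decides in that round. -/
def Simultaneity {n : ℕ} (E : InfoExchange n) (P : DecProtocol E) (t : ℕ) : Prop :=
  ∀ r ∈ Runs E P t, ∀ (m : ℕ) (i j : Fin n) (v : Values),
    Nonfailed E r m i → Nonfailed E r m j →
    P i (r.st m i) = Action.decide v → ∃ w, P j (r.st m j) = Action.decide w

/-- Termination: every agent eventually decides or fails. -/
def TerminationP {n : ℕ} (E : InfoExchange n) (P : DecProtocol E) (t : ℕ) : Prop :=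
  ∀ r ∈ Runs E P t, ∀ i : Fin n,
    (∃ m, ¬ Nonfailed E r m i) ∨ (∃ m v, P i (r.st m i) = Action.decide v)

/-- `(P,E)` is an SBA protocol in the crash failure context `Crash_t`. -/
def IsSBA {n : ℕ} (E : InfoExchange n) (P : DecProtocol E) (t : ℕ) : Prop :=
  Agreement E P t ∧ ValidityP E P t ∧ Simultaneity E P t ∧ TerminationP E P t

/-- `E` does not transmit information about actions. -/
def NoActionInfo {n : ℕ} (E : InfoExchange n) : Prop :=
  ∀ (i : Fin n) (s : E.L i) (a₁ a₂ : Action),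
    E.μ i s a₁ = E.μ i s a₂ ∧ ∀ A v, E.δ i s A a₁ v = E.δ i s A a₂ v

/-- The trivial decision protocol (used to form `I_E` for an information exchange
that does not transmit information about actions). -/
def noopProt {n : ℕ} (E : InfoExchange n) : DecProtocol E := fun _ _ => Action.noop

/-- The interpreted system `I_E` of an information exchange that does not
transmit information about actions. -/
def Sys {n : ℕ} (E : InfoExchange n) (t : ℕ) : Set (Run E) :=
  Runs E (noopProt E) t

end SBA
namespace SBA

/-- Local states of the FloodSet information exchange `E^flood`. -/
inductive FloodState where
  | crashed
  | live (W : Finset Bool) (m : ℕ) (v : Bool)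
deriving DecidableEq

/-- The `W` component of a FloodSet local state. -/
def FloodState.Wof : FloodState → Finset Bool
  | .crashed => ∅
  | .live W _ _ => W

/-- The FloodSet information exchange `E^flood`. -/
def floodE (n : ℕ) : InfoExchange n where
  L := fun _ => FloodState
  M := fun _ => Finset Bool
  crashSt := fun _ => .crashed
  initSt := fun _ v => .live {v} 0 v
  initInj := by
    intro i v v' h
    injection h with h1 h2 h3
  μ := fun _ s _ => match s with
    | .crashed => fun _ => none
    | .live W _ _ => fun _ => some W
  δ := fun _ s _ _ ms => match s with
    | .crashed => .crashed
    | .live W m v =>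
        .live (W ∪ Finset.univ.biUnion (fun j => (ms j).getD ∅)) (m+1) v

end SBA
namespace SBA

section CommonKnowledge

variable {n : ℕ} {E : InfoExchange n} {R : Set (Run E)} {φ : Form E}

/-- Common knowledge is transported along indistinguishability for nonfailed agents. -/
theorem CK.transfer {r r' : Run E} {m m' : ℕ} (h : CK E R φ r m) {i : Fin n}
    (hi : Nonfailed E r m i) (hr' : r' ∈ R) (heq : r.st m i = r'.st m' i) :
    CK E R φ r' m' := by
  intro k
  have := h (k + 1)
  rw [Function.iterate_succ_apply'] at this
  exact this i hi r' hr' m' heq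

theorem CK.holds {r r' : Run E} {m m' : ℕ} (h : CK E R φ r m) {i : Fin n}
    (hi : Nonfailed E r m i) (hr' : r' ∈ R) (heq : r.st m i = r'.st m' i) :
    φ r' m' :=
  h 0 i hi r' hr' m' heq

/-- The induction rule for common knowledge. -/
theorem CK.of_invariant {ψ : Form E} (hstep : ∀ r m, ψ r m → EvK E R ψ r m)
    (hφ : ∀ r m, ψ r m → φ r m) {r : Run E} {m : ℕ} (h : ψ r m) : CK E R φ r m := by
  have key : ∀ k r m, ψ r m → (EvK E R)^[k] φ r m := by
    intro k
    induction k with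
    | zero => exact hφ
    | succ k ih =>
      intro r m h
      rw [Function.iterate_succ_apply']
      exact fun i hi r' hr' m' heq => ih _ _ (hstep r m h i hi r' hr' m' heq)
  exact fun k => key (k + 1) r m h

end CommonKnowledge

section Flood

variable {n t : ℕ}

theorem aliveAt.mono {A : Adversary n} {q q' : ℕ} (h : q' ≤ q) {i : Fin n}
    (hi : aliveAt A q i) : aliveAt A q' i :=
  fun k hk => hi k (hk.trans h)

/-- The values seen by agent `i` at time `q`. -/
def seen (r : Run (floodE n)) (q : ℕ) (i : Fin n) : Finset Bool :=
  FloodState.Wof (r.st q i)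

theorem st_zero_eq {r : Run (floodE n)} (hr : r ∈ Sys (floodE n) t) (i : Fin n) :
    ∃ v, r.st 0 i = FloodState.live {v} 0 v :=
  hr.2.1 i

theorem st_succ_crashed {r : Run (floodE n)} (hr : r ∈ Sys (floodE n) t) {q : ℕ} {i : Fin n}
    (h : ¬ aliveAt r.env (q + 1) i) : r.st (q + 1) i = FloodState.crashed := by
  rw [hr.2.2 q i, if_neg h]; rfl

theorem st_succ_live {r : Run (floodE n)} (hr : r ∈ Sys (floodE n) t) {q : ℕ} {i : Fin n}
    (h : aliveAt r.env (q + 1) i) {W : Finset Bool} {a : ℕ} {v : Bool}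
    (hs : r.st q i = FloodState.live W a v) :
    r.st (q + 1) i = FloodState.live (W ∪ Finset.univ.biUnion
      (fun j => if r.env.F (q + 1) j i = true then seen r q j else ∅)) (a + 1) v := by
  rw [hr.2.2 q i, if_pos h, hs]
  change FloodState.live (W ∪ Finset.univ.biUnion
    (fun j => (recvd (floodE n) (noopProt (floodE n)) r q i j).getD (∅ : Finset Bool)))
    (a + 1) v = _
  congr 3
  funext j
  unfold recvd seen
  split_ifs
  · simp only [floodE]
    cases r.st q j <;> rfl
  · rfl

/-- The local state of an agent that has not crashed. -/
theorem st_eq_live {r : Run (floodE n)} (hr : r ∈ Sys (floodE n) t) {i : Fin n} {v : Bool}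
    (hv : r.st 0 i = FloodState.live {v} 0 v) {q : ℕ} (h : q = 0 ∨ aliveAt r.env q i) :
    r.st q i = FloodState.live (seen r q i) q v := by
  have : ∃ W, r.st q i = FloodState.live W q v := by
    induction q with
    | zero => exact ⟨_, hv⟩
    | succ q ih =>
      have h := h.resolve_left (Nat.succ_ne_zero q)
      obtain ⟨W, hW⟩ := ih (.inr (h.mono q.le_succ))
      exact ⟨_, st_succ_live hr h hW⟩
  obtain ⟨W, hW⟩ := this
  rw [seen, hW, FloodState.Wof]

theorem nonfailed_iff {r : Run (floodE n)} (hr : r ∈ Sys (floodE n) t) {q : ℕ} {i : Fin n} :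
    Nonfailed (floodE n) r q i ↔ q = 0 ∨ aliveAt r.env q i := by
  constructor
  · intro h
    by_contra! hc
    obtain ⟨q, rfl⟩ := Nat.exists_eq_succ_of_ne_zero hc.1
    exact h (st_succ_crashed hr hc.2)
  · intro h
    obtain ⟨v, hv⟩ := st_zero_eq hr i
    change r.st q i ≠ FloodState.crashed
    rw [st_eq_live hr hv h]
    exact FloodState.noConfusion

theorem mem_seen_succ {r : Run (floodE n)} (hr : r ∈ Sys (floodE n) t) {q : ℕ} {i : Fin n}
    (h : aliveAt r.env (q + 1) i) {x : Bool} :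
    x ∈ seen r (q + 1) i ↔
      x ∈ seen r q i ∨ ∃ j, r.env.F (q + 1) j i = true ∧ x ∈ seen r q j := by
  obtain ⟨v, hv⟩ := st_zero_eq hr i
  rw [seen, st_succ_live hr h (st_eq_live hr hv (.inr (h.mono q.le_succ)))]
  simp only [FloodState.Wof, Finset.mem_union, Finset.mem_biUnion, Finset.mem_univ, true_and]
  refine or_congr_right (exists_congr fun j => ?_)
  split_ifs with hF <;> simp [hF]

theorem seen_eq_empty {r : Run (floodE n)} {q : ℕ} {i : Fin n}
    (h : ¬ Nonfailed (floodE n) r q i) : seen r q i = ∅ := by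
  have h : r.st q i = FloodState.crashed := not_not.mp h
  rw [seen, h, FloodState.Wof]

theorem init_mem_seen {r : Run (floodE n)} (hr : r ∈ Sys (floodE n) t) {i : Fin n} {v : Bool}
    (hv : r.st 0 i = FloodState.live {v} 0 v) {q : ℕ} (h : q = 0 ∨ aliveAt r.env q i) :
    v ∈ seen r q i := by
  induction q with
  | zero => rw [seen, hv]; simp [FloodState.Wof]
  | succ q ih =>
    have h := h.resolve_left (Nat.succ_ne_zero q)
    exact (mem_seen_succ hr h).mpr (.inl (ih (.inr (h.mono q.le_succ))))

/-- Every value seen by an agent is an initial value. -/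
theorem exists_init_of_mem_seen {r : Run (floodE n)} (hr : r ∈ Sys (floodE n) t) {q : ℕ} :
    ∀ {i : Fin n} {x : Bool}, x ∈ seen r q i → ∃ j, r.st 0 j = FloodState.live {x} 0 x := by
  induction q with
  | zero =>
    intro i x hx
    obtain ⟨v, hv⟩ := st_zero_eq hr i
    rw [seen, hv, FloodState.Wof, Finset.mem_singleton] at hx
    exact ⟨i, hx ▸ hv⟩
  | succ q ih =>
    intro i x hx
    by_cases h : aliveAt r.env (q + 1) i
    · rcases (mem_seen_succ hr h).mp hx with h1 | ⟨j, -, h1⟩ <;> exact ih h1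
    · rw [seen, st_succ_crashed hr h] at hx
      simp [FloodState.Wof] at hx

theorem Nonfailed.of_succ {r : Run (floodE n)} (hr : r ∈ Sys (floodE n) t) {q : ℕ} {i : Fin n}
    (h : Nonfailed (floodE n) r (q + 1) i) : Nonfailed (floodE n) r q i :=
  (nonfailed_iff hr).mpr
    (.inr ((((nonfailed_iff hr).mp h).resolve_left q.succ_ne_zero).mono q.le_succ))

open Classical in
theorem card_nonfailed_ge {r : Run (floodE n)} (hr : r ∈ Sys (floodE n) t) (q : ℕ) :
    n ≤ (Finset.univ.filter (Nonfailed (floodE n) r q)).card + t := by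
  have hc := Finset.card_filter_add_card_filter_not (s := (Finset.univ : Finset (Fin n)))
    (Nonfailed (floodE n) r q)
  rw [Finset.card_univ, Fintype.card_fin] at hc
  have hsub : (Finset.univ.filter fun i => ¬ Nonfailed (floodE n) r q i).card ≤ t := by
    refine le_trans ?_ hr.1.2.2
    rw [← Set.ncard_coe_finset]
    refine Set.ncard_le_ncard ?_ (Set.toFinite _)
    intro i hi
    simp only [Finset.coe_filter, Finset.mem_univ, true_and, Set.mem_ofPred_eq,
      nonfailed_iff hr, not_or, aliveAt] at hi
    obtain ⟨-, hi⟩ := hi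
    push Not at hi
    obtain ⟨k, -, hk⟩ := hi
    exact ⟨k, i, by simpa using hk⟩
  omega

theorem exists_nonfailed (ht : t < n) {r : Run (floodE n)} (hr : r ∈ Sys (floodE n) t) (q : ℕ) :
    ∃ i, Nonfailed (floodE n) r q i := by
  classical
  have := card_nonfailed_ge hr q
  obtain ⟨i, hi⟩ := Finset.card_pos.mp
    (show 0 < (Finset.univ.filter (Nonfailed (floodE n) r q)).card by omega)
  exact ⟨i, (Finset.mem_filter.mp hi).2⟩

open Classical in
/-- Either the nonfailed agents agree on the values seen, or every round so far had a crash. -/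
theorem seen_agree_or_card_le {r : Run (floodE n)} (hr : r ∈ Sys (floodE n) t) (q : ℕ) :
    (∀ i j, Nonfailed (floodE n) r q i → Nonfailed (floodE n) r q j → seen r q i = seen r q j) ∨
      (Finset.univ.filter (Nonfailed (floodE n) r q)).card + q ≤ n := by
  induction q with
  | zero =>
    right
    simpa using Finset.card_filter_le (Finset.univ : Finset (Fin n)) _
  | succ q ih =>
    have alive : ∀ {i}, Nonfailed (floodE n) r (q + 1) i → aliveAt r.env (q + 1) i :=
      fun h => ((nonfailed_iff hr).mp h).resolve_left q.succ_ne_zero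
    rcases ih with ih | ih
    · left
      have key : ∀ i, Nonfailed (floodE n) r (q + 1) i → seen r (q + 1) i = seen r q i := by
        intro i hi
        ext x
        rw [mem_seen_succ hr (alive hi)]
        refine ⟨?_, .inl⟩
        rintro (h | ⟨j, -, h⟩)
        · exact h
        · by_cases hj : Nonfailed (floodE n) r q j
          · rwa [ih i j (hi.of_succ hr) hj]
          · simp [seen_eq_empty hj] at h
      intro i j hi hj
      rw [key i hi, key j hj, ih i j (hi.of_succ hr) (hj.of_succ hr)]
    · have hsub : Finset.univ.filter (Nonfailed (floodE n) r (q + 1)) ⊆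
          Finset.univ.filter (Nonfailed (floodE n) r q) :=
        Finset.monotone_filter_right _ fun i _ hi => Nonfailed.of_succ hr hi
      rcases hsub.eq_or_ssubset with heq | hss
      · left
        have key : ∀ i, Nonfailed (floodE n) r (q + 1) i → ∀ x,
            x ∈ seen r (q + 1) i ↔ ∃ j, x ∈ seen r q j := by
          intro i hi x
          rw [mem_seen_succ hr (alive hi)]
          constructor
          · rintro (h | ⟨j, -, h⟩)
            exacts [⟨i, h⟩, ⟨j, h⟩]
          · rintro ⟨j, h⟩
            have hj : Nonfailed (floodE n) r q j := by
              by_contra hj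
              simp [seen_eq_empty hj] at h
            have hj' : Nonfailed (floodE n) r (q + 1) j := by
              have : j ∈ Finset.univ.filter (Nonfailed (floodE n) r (q + 1)) := by
                rw [heq]; simpa using hj
              simpa using this
            refine .inr ⟨j, ?_, h⟩
            by_contra hF
            have := hr.1.2.1 (q + 1) j i (by simpa using hF)
            rw [alive hj' (q + 1) le_rfl] at this
            exact Bool.noConfusion this
        intro i j hi hj
        ext x
        rw [key i hi, key j hj]
      · right
        have := Finset.card_lt_card hss
        omega

theorem seen_agree (ht : t < n) {r : Run (floodE n)} (hr : r ∈ Sys (floodE n) t) {m : ℕ}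
    (hm : min (t + 1) (n - 1) ≤ m) {i j : Fin n}
    (hi : Nonfailed (floodE n) r m i) (hj : Nonfailed (floodE n) r m j) :
    seen r m i = seen r m j := by
  classical
  rcases seen_agree_or_card_le hr m with h | h
  · exact h i j hi hj
  · have h1 := card_nonfailed_ge hr m
    have h2 : (Finset.univ.filter (Nonfailed (floodE n) r m)).card ≤ 1 := by omega
    rw [Finset.card_le_one.mp h2 i (by simpa using hi) j (by simpa using hj)]

/-- The local states of the FloodSet run with adversary `A` and initial values `v`. -/
def floodStates (A : Adversary n) (v : Fin n → Bool) : ℕ → Fin n → FloodState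
  | 0, i => .live {v i} 0 (v i)
  | k + 1, i =>
    if aliveAt A (k + 1) i then
      (floodE n).δ i (floodStates A v k i) A .noop
        (fun j => if A.F (k + 1) j i = true then
          (floodE n).μ j (floodStates A v k j) .noop i else none)
    else .crashed

/-- The FloodSet run with adversary `A` and initial values `v`. -/
def floodRun (A : Adversary n) (v : Fin n → Bool) : Run (floodE n) where
  env := A
  st := floodStates A v

theorem floodRun_mem_Sys {A : Adversary n} (hA : A.Valid t) (v : Fin n → Bool) :
    floodRun A v ∈ Sys (floodE n) t :=
  ⟨hA, fun i => ⟨v i, rfl⟩, fun _ _ => rfl⟩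

/-- The adversary under which no agent fails. -/
def noFailures (n : ℕ) : Adversary n := ⟨fun _ _ _ => true⟩

theorem noFailures_valid : (noFailures n).Valid t := by
  simp [Adversary.Valid, noFailures]

/-- The agents at positions `0, …, m - 1` crash one per round, each delivering in its last round
only to the agent at the next position. -/
def chainAdversary (m : ℕ) (pos : Fin n ≃ Fin n) : Adversary n where
  F q a b := decide (m ≤ (pos a : ℕ) ∨ q ≤ (pos a : ℕ) ∨
    (q = (pos a : ℕ) + 1 ∧ (pos b : ℕ) = (pos a : ℕ) + 1))

theorem chainAdversary_valid {m : ℕ} (hm : m ≤ t) (pos : Fin n ≃ Fin n) :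
    (chainAdversary m pos).Valid t := by
  refine ⟨?_, ?_, ?_⟩
  · intro q i h q' hq k
    simp only [chainAdversary, decide_eq_false_iff_not] at h ⊢
    omega
  · intro q i j h
    simp only [chainAdversary, decide_eq_false_iff_not] at h ⊢
    omega
  · refine le_trans ?_ ((Finset.card_range m).trans_le hm)
    rw [← Set.ncard_image_of_injective (f := fun i => (pos i : ℕ)) _
      (Fin.val_injective.comp pos.injective), ← Set.ncard_coe_finset]
    refine Set.ncard_le_ncard ?_ (Finset.finite_toSet _)
    rintro _ ⟨i, ⟨q, j, h⟩, rfl⟩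
    simp only [chainAdversary, decide_eq_false_iff_not] at h
    exact Finset.mem_coe.mpr (Finset.mem_range.mpr (show (pos i : ℕ) < m by omega))

theorem exists_perm_map_pair {α : Type*} [DecidableEq α] {a b a' b' : α} (h : a ≠ b)
    (h' : a' ≠ b') : ∃ σ : Equiv.Perm α, σ a = a' ∧ σ b = b' := by
  refine ⟨(Equiv.swap a a').trans (Equiv.swap (Equiv.swap a a' b) b'), ?_, by simp⟩
  have : Equiv.swap a a' b ≠ a' := by
    rw [Ne, Equiv.swap_apply_eq_iff, Equiv.swap_apply_right]
    exact h.symm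
  simp [Equiv.swap_apply_of_ne_of_ne this.symm h']

theorem eq_univ_of_mem {W : Finset Bool} {v : Bool} (h : v ∈ W) (h' : (!v) ∈ W) :
    W = Finset.univ := by
  ext x
  cases x <;> cases v <;> simp_all

/-- A run in which agent `k` learns the value `!v` just in time `m`, and agent `i` does not. -/
theorem exists_chain_run {m : ℕ} (hmt : m ≤ t) (hmn : m + 2 ≤ n) {i k : Fin n} (hik : i ≠ k)
    (v : Bool) : ∃ r ∈ Sys (floodE n) t,
      r.st m i = FloodState.live {v} m v ∧
      r.st m k = if m = 0 then FloodState.live {!v} 0 (!v)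
        else FloodState.live Finset.univ m v := by
  obtain ⟨pos, hk, hi⟩ := exists_perm_map_pair (a := k) (b := i) (a' := ⟨m, by omega⟩)
    (b' := (⟨m + 1, by omega⟩ : Fin n)) hik.symm (by simp)
  have hk : (pos k : ℕ) = m := by rw [hk]
  have hi : (pos i : ℕ) = m + 1 := by rw [hi]
  let ival : Fin n → Bool := fun a => if (pos a : ℕ) = 0 then !v else v
  let r := floodRun (chainAdversary m pos) ival
  have hr : r ∈ Sys (floodE n) t := floodRun_mem_Sys (chainAdversary_valid hmt pos) _
  have hst : ∀ a, r.st 0 a = FloodState.live {ival a} 0 (ival a) := fun _ => rfl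
  have halive : ∀ q ≤ m, ∀ a, aliveAt r.env q a ↔ q ≤ (pos a : ℕ) := by
    intro q hq a
    simp only [aliveAt, r, floodRun, chainAdversary, decide_eq_true_eq]
    constructor
    · intro h
      have := h q le_rfl
      omega
    · intro h k hk
      omega
  have hseen : ∀ q ≤ m, ∀ a, ((pos a : ℕ) = q → (!v) ∈ seen r q a) ∧
      (q < (pos a : ℕ) → seen r q a = {v}) := by
    intro q
    induction q with
    | zero =>
      intro _ a
      rw [seen, hst]
      constructor <;> intro h
      · simp [FloodState.Wof, ival, h]
      · simp [FloodState.Wof, ival, h.ne']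
    | succ q ih =>
      intro hq a
      have ih := ih (by omega)
      have hF : ∀ b, r.env.F (q + 1) b a = true ↔ (m ≤ (pos b : ℕ) ∨ q + 1 ≤ (pos b : ℕ) ∨
        (q + 1 = (pos b : ℕ) + 1 ∧ (pos a : ℕ) = (pos b : ℕ) + 1)) := by
        simp [r, floodRun, chainAdversary]
      constructor <;> intro h
      · rw [mem_seen_succ hr ((halive _ hq a).mpr h.ge)]
        let b := pos.symm ⟨q, by omega⟩
        have hb : (pos b : ℕ) = q := by simp [b]
        exact .inr ⟨b, (hF b).mpr (by omega), (ih b).1 hb⟩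
      · ext x
        rw [mem_seen_succ hr ((halive _ hq a).mpr h.le), (ih a).2 (by omega)]
        refine ⟨?_, .inl⟩
        rintro (h1 | ⟨b, h1, h2⟩)
        · exact h1
        · rw [hF] at h1
          rwa [(ih b).2 (by omega)] at h2
  refine ⟨r, hr, ?_, ?_⟩
  · rw [st_eq_live hr (hst i) (.inr ((halive m le_rfl i).mpr (by omega))),
      (hseen m le_rfl i).2 (by omega)]
    simp only [ival, hi, Nat.add_one_ne_zero, if_false]
    rfl
  · have ha := (halive m le_rfl k).mpr hk.ge
    split_ifs with hm0
    · subst hm0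
      rw [hst]
      simp only [ival, hk, if_true]
      rfl
    · have hival : ival k = v := by simp [ival, hk, hm0]
      have hs := hst k
      rw [hival] at hs
      rw [st_eq_live hr hs (.inr ha),
        eq_univ_of_mem (init_mem_seen hr hs (.inr ha)) ((hseen m le_rfl k).1 hk)]

/-- A failure-free run in which exactly agent `k` has initial value `v`. -/
theorem exists_mixed_run (t : ℕ) {m : ℕ} (hm : m ≠ 0) {i k : Fin n} (hik : i ≠ k) (v : Bool) :
    ∃ r ∈ Sys (floodE n) t,
      r.st m k = FloodState.live Finset.univ m v ∧
      r.st m i = FloodState.live Finset.univ m (!v) := by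
  let ival : Fin n → Bool := fun a => if a = k then v else !v
  let r := floodRun (noFailures n) ival
  have hr : r ∈ Sys (floodE n) t := floodRun_mem_Sys noFailures_valid _
  have hst : ∀ a, r.st 0 a = FloodState.live {ival a} 0 (ival a) := fun _ => rfl
  have halive : ∀ q a, aliveAt r.env q a := fun _ _ _ _ => rfl
  obtain ⟨q, rfl⟩ := Nat.exists_eq_succ_of_ne_zero hm
  have hmem : ∀ a b, ival b ∈ seen r (q + 1) a := fun a b =>
    (mem_seen_succ hr (halive _ a)).mpr (.inr ⟨b, rfl, init_mem_seen hr (hst b) (.inr (halive _ b))⟩)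
  have hk : ival k = v := by simp [ival]
  have hi : ival i = !v := by simp [ival, hik]
  have huniv : ∀ a, seen r (q + 1) a = Finset.univ := fun a =>
    eq_univ_of_mem (hk ▸ hmem a k) (hi ▸ hmem a i)
  refine ⟨r, hr, ?_, ?_⟩
  · rw [st_eq_live hr (hst k) (.inr (halive _ k)), huniv, hk]
  · rw [st_eq_live hr (hst i) (.inr (halive _ i)), huniv, hi]

/-- A run in which all agents have initial value `v`. -/
theorem exists_constant_run (n t m : ℕ) (v : Bool) : ∃ r ∈ Sys (floodE n) t,
    (∀ i, r.st 0 i = FloodState.live {v} 0 v) ∧ ∀ i, r.st m i = FloodState.live {v} m v := by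
  let r := floodRun (noFailures n) fun _ => v
  have hr : r ∈ Sys (floodE n) t := floodRun_mem_Sys noFailures_valid _
  have hst : ∀ a, r.st 0 a = FloodState.live {v} 0 v := fun _ => rfl
  refine ⟨r, hr, hst, fun i => ?_⟩
  have ha : m = 0 ∨ aliveAt r.env m i := .inr fun _ _ => rfl
  rw [st_eq_live hr (hst i) ha]
  congr 1
  ext x
  rw [Finset.mem_singleton]
  constructor
  · intro hx
    obtain ⟨j, hj⟩ := exists_init_of_mem_seen hr hx
    rw [hst j] at hj
    injection hj with _ _ h
    exact h.symm
  · rintro rfl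
    exact init_mem_seen hr (hst i) ha

/-- Before time `min (t + 1) (n - 1)` there is no common knowledge of an initial value. -/
theorem not_CK_existsVal (ht : t < n) {m : ℕ} (hmt : m ≤ t) (hmn : m + 2 ≤ n) (x : Bool)
    {r : Run (floodE n)} (hr : r ∈ Sys (floodE n) t) :
    ¬ CK (floodE n) (Sys (floodE n) t) (ExistsVal (floodE n) x) r m := by
  have other : ∀ k : Fin n, ∃ i, i ≠ k := by
    have : Nontrivial (Fin n) := Fin.nontrivial_iff_two_le.mpr (by omega)
    exact exists_ne
  have nf : ∀ {s : Run (floodE n)} {i W a v}, s.st m i = FloodState.live W a v →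
      Nonfailed (floodE n) s m i := by
    intro s i W a v h
    change s.st m i ≠ FloodState.crashed
    rw [h]
    exact FloodState.noConfusion
  have only_other : ∀ s : Run (floodE n), ∀ i, s.st m i = FloodState.live {!x} m (!x) →
      ¬ CK (floodE n) (Sys (floodE n) t) (ExistsVal (floodE n) x) s m := by
    intro s i hs hck
    obtain ⟨s', hs', h0, hm⟩ := exists_constant_run n t m (!x)
    obtain ⟨j, hj⟩ := hck.holds (nf hs) hs' (hs.trans (hm i).symm)
    rw [h0 j] at hj
    injection hj with _ _ h
    simp at h
  have both_other : m ≠ 0 → ∀ s : Run (floodE n), ∀ k,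
      s.st m k = FloodState.live Finset.univ m (!x) →
      ¬ CK (floodE n) (Sys (floodE n) t) (ExistsVal (floodE n) x) s m := by
    intro hm s k hs hck
    obtain ⟨i, hik⟩ := other k
    obtain ⟨s', hs', h1, h2⟩ := exists_chain_run hmt hmn hik (!x)
    rw [if_neg hm] at h2
    exact only_other s' i h1 (hck.transfer (nf hs) hs' (hs.trans h2.symm))
  have both_same : m ≠ 0 → ∀ s : Run (floodE n), ∀ k,
      s.st m k = FloodState.live Finset.univ m x →
      ¬ CK (floodE n) (Sys (floodE n) t) (ExistsVal (floodE n) x) s m := by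
    intro hm s k hs hck
    obtain ⟨i, hik⟩ := other k
    obtain ⟨s', hs', h1, h2⟩ := exists_mixed_run t hm hik x
    exact both_other hm s' i h2 (hck.transfer (nf hs) hs' (hs.trans h1.symm))
  have only_same : ∀ s : Run (floodE n), ∀ i, s.st m i = FloodState.live {x} m x →
      ¬ CK (floodE n) (Sys (floodE n) t) (ExistsVal (floodE n) x) s m := by
    intro s i hs hck
    obtain ⟨k, hki⟩ := other i
    obtain ⟨s', hs', h1, h2⟩ := exists_chain_run hmt hmn hki.symm x
    have hck' := hck.transfer (nf hs) hs' (hs.trans h1.symm)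
    by_cases hm : m = 0
    · subst hm
      exact only_other s' k h2 hck'
    · rw [if_neg hm] at h2
      exact both_same hm s' k h2 hck'
  obtain ⟨i, hi⟩ := exists_nonfailed ht hr m
  have hi := (nonfailed_iff hr).mp hi
  obtain ⟨v, hv⟩ := st_zero_eq hr i
  have hst := st_eq_live hr hv hi
  have hmem := init_mem_seen hr hv hi
  by_cases hW : (!v) ∈ seen r m i
  · rw [eq_univ_of_mem hmem hW] at hst
    have hm : m ≠ 0 := by
      rintro rfl
      rw [seen, hv, FloodState.Wof] at hW
      simp at hW
    rcases Bool.eq_or_eq_not v x with rfl | rfl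
    · exact both_same hm r i hst
    · exact both_other hm r i hst
  · have : seen r m i = {v} := by
      ext y
      rcases Bool.eq_or_eq_not y v with rfl | rfl
      · simpa using hmem
      · simpa using hW
    rw [this] at hst
    rcases Bool.eq_or_eq_not v x with rfl | rfl
    · exact only_same r i hst
    · exact only_other r i hst

/-- From time `min (t + 1) (n - 1)` on, a value seen by a nonfailed agent is known to be
commonly known to occur. -/
theorem Kn_CK_of_mem_seen (ht : t < n) {m : ℕ} (hm : min (t + 1) (n - 1) ≤ m)
    {r : Run (floodE n)} (hr : r ∈ Sys (floodE n) t) {i : Fin n}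
    (hi : Nonfailed (floodE n) r m i) {x : Bool} (hx : x ∈ seen r m i) :
    Kn (floodE n) (Sys (floodE n) t) i
      (CK (floodE n) (Sys (floodE n) t) (ExistsVal (floodE n) x)) r m := by
  let ψ : Form (floodE n) := fun s q => s ∈ Sys (floodE n) t ∧ q = m ∧
    ∀ j, Nonfailed (floodE n) s m j → x ∈ seen s m j
  have step : ∀ s ∈ Sys (floodE n) t, ∀ j, Nonfailed (floodE n) s m j → x ∈ seen s m j →
      ∀ s' ∈ Sys (floodE n) t, ∀ q, s.st m j = s'.st q j → ψ s' q := by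
    intro s hs j hj hxj s' hs' q heq
    have hj' : Nonfailed (floodE n) s' q j := fun h => hj (heq.trans h)
    obtain ⟨v, hv⟩ := st_zero_eq hs j
    obtain ⟨v', hv'⟩ := st_zero_eq hs' j
    have heq' := heq
    rw [st_eq_live hs hv ((nonfailed_iff hs).mp hj),
      st_eq_live hs' hv' ((nonfailed_iff hs').mp hj')] at heq'
    injection heq' with h1 h2 _
    subst h2
    refine ⟨hs', rfl, fun k hk => ?_⟩
    rw [seen_agree ht hs' hm hk hj', ← h1]
    exact hxj
  intro r' hr' m' heq
  refine CK.of_invariant (ψ := ψ) ?_ ?_ (step r hr i hi hx r' hr' m' heq)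
  · rintro s q ⟨hs, rfl, hall⟩ j hj s' hs' q' heq
    exact step s hs j hj (hall j hj) s' hs' q' heq
  · rintro s q ⟨hs, rfl, hall⟩
    obtain ⟨j, hj⟩ := exists_nonfailed ht hs q
    exact exists_init_of_mem_seen hs (hall j hj)

end Flood

/-- in the interpreted system of the FloodSet information
exchange `E^flood` under `Crash_t`, at a point `(r,m)`,
`K_i(C_N(∃0)) ∨ K_i(C_N(∃1))` holds for all nonfailed agents `i` if and only if
`m ≥ min {t+1, n-1}`. -/
theorem flood_knowledge_of_common_knowledge_iff
    {n t : ℕ} (ht : t < n) (r : Run (floodE n))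
    (hr : r ∈ Sys (floodE n) t) (m : ℕ) :
    (∀ i : Fin n, Nonfailed (floodE n) r m i →
        (Kn (floodE n) (Sys (floodE n) t) i
          (CK (floodE n) (Sys (floodE n) t) (ExistsVal (floodE n) false)) r m ∨
         Kn (floodE n) (Sys (floodE n) t) i
          (CK (floodE n) (Sys (floodE n) t) (ExistsVal (floodE n) true)) r m))
    ↔ min (t+1) (n-1) ≤ m := by
  constructor
  · intro h
    by_contra! hlt
    obtain ⟨i, hi⟩ := exists_nonfailed ht hr m
    rcases h i hi with h | h <;>
      exact not_CK_existsVal ht (by omega) (by omega) _ hr (h r hr m rfl)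
  · intro hm i hi
    obtain ⟨v, hv⟩ := st_zero_eq hr i
    have := Kn_CK_of_mem_seen ht hm hr hi (init_mem_seen hr hv ((nonfailed_iff hr).mp hi))
    cases v
    exacts [.inl this, .inr this]

end SBA
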